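/- Let V ∈ C(X×Y) be nonnegative and κ > 0. Suppose (μ_n)_n are probability measures on X converging weak* to μ, (ν_n)_n are probability measures on Y converging weak* to ν, and (ρ_n)_n are probability measures on X×Y converging weak* to ρ. Then E(ρ | μ, ν) ≤ liminf_{n→∞} E(ρ_n | μ_n, ν_n), where E(σ | μ', ν') := ∫ V dσ + κ H(σ|ν') if σ is a coupling of μ' and ν', and +∞ otherwise. -/

import Mathlib

open MeasureTheory ProbabilityTheory Filter Set
open scoped ENNReal Topology BoundedContinuousFunction

noncomputable section

abbrev Euc (n : ℕ) : Type := EuclideanSpace ℝ (Fin n)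

/-- The set of couplings (transport plans) between two measures. -/
def Couplings {α β : Type*} [MeasurableSpace α] [MeasurableSpace β]
    (μ : Measure α) (ν : Measure β) : Set (Measure (α × β)) :=
  {γ | IsProbabilityMeasure γ ∧ γ.map Prod.fst = μ ∧ γ.map Prod.snd = ν}

/-- The integrand `s ↦ s log s − s + 1` of the entropy. -/
def entT (s : ℝ) : ℝ := s * Real.log s - s + 1

open scoped Classical in
/-- Weighted negative entropy of `ρ` relative to the reference measure `π`. -/
noncomputable def entropyH {α : Type*} [MeasurableSpace α] (π ρ : Measure α) : ℝ≥0∞ :=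
  if ρ ≪ π then ∫⁻ p, ENNReal.ofReal (entT ((ρ.rnDeriv π p).toReal)) ∂π else ⊤

/-- The reference measure `𝓛|X ⊗ ν'` on `X × Y`. -/
noncomputable def Lref {d d' : ℕ} (X : Set (Euc d)) (ν : Measure (Euc d')) :
    Measure (Euc d × Euc d') :=
  (MeasureTheory.volume.restrict X).prod ν

open scoped Classical in
/-- The marginal-dependent energy `E(σ | μ', ν') = ∫ V dσ + κ H(σ|ν')` if `σ ∈ Γ(μ',ν')`,
and `+∞` otherwise. -/
noncomputable def energyMid {d d' : ℕ} (X : Set (Euc d)) (V : Euc d × Euc d' → ℝ) (κ : ℝ)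
    (σ : Measure (Euc d × Euc d')) (μ' : Measure (Euc d)) (ν' : Measure (Euc d')) : ℝ≥0∞ :=
  if σ ∈ Couplings μ' ν' then
    (∫⁻ p, ENNReal.ofReal (V p) ∂σ) + ENNReal.ofReal κ * entropyH (Lref X ν') σ
  else ⊤

/-- Weak* convergence of a sequence of measures. -/
def WeakStarTendsto {α : Type*} [MeasurableSpace α] [TopologicalSpace α]
    (μs : ℕ → Measure α) (μ : Measure α) : Prop :=
  ∀ f : α →ᵇ ℝ, Tendsto (fun n => ∫ x, f x ∂(μs n)) atTop (𝓝 (∫ x, f x ∂μ))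

/-- The dual functional `f ↦ ∫ f dσ - ∫ (e^f - 1) dπ` of the entropy of `σ` relative to `π`. -/
def entropyDual {α : Type*} [MeasurableSpace α] (π σ : Measure α) (f : α → ℝ) : ℝ :=
  ∫ x, f x ∂σ - ∫ x, (Real.exp (f x) - 1) ∂π

lemma entT_eq_klFun (s : ℝ) : entT s = InformationTheory.klFun s := by
  simp only [entT, InformationTheory.klFun]; ring

lemma integrable_of_abs_le {α : Type*} [MeasurableSpace α] {π : Measure α} [IsFiniteMeasure π]
    {f : α → ℝ} (hf : Measurable f) {M : ℝ} (hM : ∀ x, |f x| ≤ M) : Integrable f π :=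
  Integrable.of_bound hf.aestronglyMeasurable M (Eventually.of_forall hM)

lemma integrable_exp_of_abs_le {α : Type*} [MeasurableSpace α] {π : Measure α}
    [IsFiniteMeasure π] {f : α → ℝ} (hf : Measurable f) {M : ℝ} (hM : ∀ x, |f x| ≤ M) :
    Integrable (fun x => Real.exp (f x)) π :=
  integrable_of_abs_le (Real.measurable_exp.comp hf) (M := Real.exp M) fun x => by
    rw [abs_of_pos (Real.exp_pos _)]
    exact Real.exp_le_exp.2 ((le_abs_self _).trans (hM x))

/-- The Fenchel–Young inequality for `s log s - s + 1` and its conjugate `e^t - 1`. -/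
lemma mul_sub_exp_le_entT {s : ℝ} (hs : 0 ≤ s) (t : ℝ) : s * t - (Real.exp t - 1) ≤ entT s := by
  unfold entT
  rcases hs.eq_or_lt with rfl | hs
  · have := Real.exp_pos t
    simp only [zero_mul]; linarith
  · have h := Real.add_one_le_exp (t - Real.log s)
    rw [Real.exp_sub, Real.exp_log hs, le_div_iff₀ hs] at h
    nlinarith

lemma ofReal_integral_le_lintegral_ofReal {α : Type*} [MeasurableSpace α] {π : Measure α}
    {f : α → ℝ} (hf : Integrable f π) :
    ENNReal.ofReal (∫ x, f x ∂π) ≤ ∫⁻ x, ENNReal.ofReal (f x) ∂π := by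
  have h : ∫ x, f x ∂π ≤ ∫ x, max (f x) 0 ∂π :=
    integral_mono hf hf.pos_part fun x => le_max_left _ _
  refine (ENNReal.ofReal_le_ofReal h).trans ?_
  rw [ofReal_integral_eq_lintegral_ofReal hf.pos_part
    (Eventually.of_forall fun x => le_max_right _ _)]
  exact lintegral_mono fun x => by simp

lemma ofReal_entropyDual_le {α : Type*} [MeasurableSpace α] {π σ : Measure α}
    [IsFiniteMeasure π] [IsFiniteMeasure σ] {f : α → ℝ} (hf : Measurable f) {M : ℝ}
    (hM : ∀ x, |f x| ≤ M) : ENNReal.ofReal (entropyDual π σ f) ≤ entropyH π σ := by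
  unfold entropyH
  split_ifs with h
  · have h1 : Integrable (fun x => (σ.rnDeriv π x).toReal * f x) π :=
      (integrable_rnDeriv_smul_iff h).2 (integrable_of_abs_le hf hM)
    have h2 : Integrable (fun x => Real.exp (f x) - 1) π :=
      (integrable_exp_of_abs_le hf hM).sub (integrable_const _)
    rw [entropyDual, ← integral_toReal_rnDeriv_mul h, ← integral_sub h1 h2]
    refine (ofReal_integral_le_lintegral_ofReal (h1.sub h2)).trans (lintegral_mono fun x => ?_)
    exact ENNReal.ofReal_le_ofReal (mul_sub_exp_le_entT ENNReal.toReal_nonneg _)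
  · exact le_top

lemma abs_exp_sub_exp_le {a b M : ℝ} (ha : |a| ≤ M) (hb : |b| ≤ M) :
    |Real.exp a - Real.exp b| ≤ Real.exp M * |a - b| := by
  have key : ∀ a b : ℝ, a ≤ M → Real.exp a - Real.exp b ≤ Real.exp M * |a - b| := by
    intro a b ha
    have h1 : Real.exp a * (b - a + 1) ≤ Real.exp b := by
      calc _ ≤ Real.exp a * Real.exp (b - a) := by
            gcongr; exact Real.add_one_le_exp _
        _ = _ := by rw [← Real.exp_add]; ring_nf
    calc _ ≤ Real.exp a * (a - b) := by linarith
      _ ≤ Real.exp a * |a - b| := by gcongr; exact le_abs_self _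
      _ ≤ _ := by gcongr
  rw [abs_le']
  refine ⟨key a b ((le_abs_self a).trans ha), ?_⟩
  rw [neg_sub, abs_sub_comm]
  exact key b a ((le_abs_self b).trans hb)

/-- A bound on the dual functional over bounded continuous functions extends to bounded
measurable functions. -/
lemma entropyDual_le_of_forall_continuous {α : Type*} [MeasurableSpace α] [TopologicalSpace α]
    [TopologicalSpace.PseudoMetrizableSpace α] [BorelSpace α] {π σ : Measure α}
    [IsFiniteMeasure π] [IsFiniteMeasure σ] {K : ℝ}
    (hK : ∀ f : α →ᵇ ℝ, entropyDual π σ f ≤ K) {f : α → ℝ} (hf : Measurable f) {M : ℝ}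
    (hM : ∀ x, |f x| ≤ M) : entropyDual π σ f ≤ K := by
  rcases isEmpty_or_nonempty α with hα | ⟨⟨x₀⟩⟩
  · simpa [entropyDual, Measure.eq_zero_of_isEmpty] using hK 0
  have hM0 : 0 ≤ M := (abs_nonneg _).trans (hM x₀)
  refine le_of_forall_pos_le_add fun ε hε => ?_
  have hC : 0 < 1 + Real.exp M := by positivity
  obtain ⟨g, hg, -⟩ :=
    (integrable_of_abs_le (π := σ + π) hf hM).exists_boundedContinuous_integral_sub_le
      (div_pos hε hC)
  let h : α →ᵇ ℝ := BoundedContinuousFunction.ofNormedAddCommGroup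
    (fun x => max (-M) (min M (g x))) (by fun_prop) M fun x => by
      rw [Real.norm_eq_abs, abs_le]
      exact ⟨le_max_left _ _, max_le (by linarith) (min_le_left _ _)⟩
  have h_apply : ∀ x, h x = max (-M) (min M (g x)) := fun x => rfl
  have hhM : ∀ x, |h x| ≤ M := fun x => by
    rw [h_apply, abs_le]
    exact ⟨le_max_left _ _, max_le (by linarith) (min_le_left _ _)⟩
  have hhm : Measurable h := h.continuous.measurable
  have hfh : ∀ x, |f x - h x| ≤ |f x - g x| := fun x => by
    have e : f x = max (-M) (min M (f x)) := by
      have := abs_le.1 (hM x)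
      rw [min_eq_right this.2, max_eq_right this.1]
    calc |f x - h x| = |max (-M) (min M (f x)) - max (-M) (min M (g x))| := by
          rw [← e, h_apply]
      _ ≤ |min M (f x) - min M (g x)| := by
          simpa [max_comm] using abs_max_sub_max_le_abs (min M (f x)) (min M (g x)) (-M)
      _ ≤ |f x - g x| := by
          simpa using abs_min_sub_min_le_max M (f x) M (g x)
  have hfi : ∀ τ : Measure α, IsFiniteMeasure τ → Integrable f τ :=
    fun τ _ => integrable_of_abs_le hf hM
  have hhi : ∀ τ : Measure α, IsFiniteMeasure τ → Integrable h τ :=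
    fun τ _ => integrable_of_abs_le hhm hhM
  have hgi : ∀ τ : Measure α, IsFiniteMeasure τ → Integrable g τ := fun τ _ => g.integrable τ
  have hσ : ∫ x, f x ∂σ - ∫ x, h x ∂σ ≤ ∫ x, ‖f x - g x‖ ∂σ := by
    rw [← integral_sub (hfi σ inferInstance) (hhi σ inferInstance)]
    exact integral_mono ((hfi σ inferInstance).sub (hhi σ inferInstance))
      ((hfi σ inferInstance).sub (hgi σ inferInstance)).norm
      fun x => (le_abs_self _).trans (hfh x)
  have hπ : ∫ x, (Real.exp (h x) - 1) ∂π - ∫ x, (Real.exp (f x) - 1) ∂π ≤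
      Real.exp M * ∫ x, ‖f x - g x‖ ∂π := by
    have i1 := (integrable_exp_of_abs_le (π := π) hhm hhM).sub (integrable_const 1)
    have i2 := (integrable_exp_of_abs_le (π := π) hf hM).sub (integrable_const 1)
    refine (integral_sub i1 i2).symm.trans_le ?_
    rw [← integral_const_mul]
    refine integral_mono (i1.sub i2)
      (((hfi π inferInstance).sub (hgi π inferInstance)).norm.const_mul _) fun x => ?_
    have := (le_abs_self _).trans (abs_exp_sub_exp_le (hhM x) (hM x))
    have h' := mul_le_mul_of_nonneg_left (hfh x) (Real.exp_pos M).le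
    rw [abs_sub_comm] at this
    simp only [Pi.sub_apply, Real.norm_eq_abs]
    linarith
  have hg' : ∫ x, ‖f x - g x‖ ∂σ + ∫ x, ‖f x - g x‖ ∂π ≤ ε / (1 + Real.exp M) := by
    refine (integral_add_measure ((hfi σ inferInstance).sub (hgi σ inferInstance)).norm
      ((hfi π inferInstance).sub (hgi π inferInstance)).norm).symm.trans_le hg
  have p1 : 0 ≤ ∫ x, ‖f x - g x‖ ∂σ := integral_nonneg fun x => norm_nonneg _
  have p2 : 0 ≤ ∫ x, ‖f x - g x‖ ∂π := integral_nonneg fun x => norm_nonneg _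
  have hKh := hK h
  rw [le_div_iff₀ hC] at hg'
  have hM' := Real.exp_pos M
  unfold entropyDual at hKh ⊢
  nlinarith [mul_nonneg p1 hM'.le]

lemma absolutelyContinuous_of_entropyDual_le {α : Type*} [MeasurableSpace α] {π σ : Measure α}
    [IsFiniteMeasure σ] {K : ℝ}
    (hK : ∀ f : α → ℝ, Measurable f → ∀ M, (∀ x, |f x| ≤ M) → entropyDual π σ f ≤ K) :
    σ ≪ π := by
  refine Measure.AbsolutelyContinuous.mk fun A hA hπA => ?_
  have key : ∀ n : ℕ, n * σ.real A ≤ K := fun n => by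
    have h := hK (A.indicator fun _ => (n : ℝ)) (measurable_const.indicator hA) n fun x => by
      by_cases hx : x ∈ A <;> simp [hx]
    have h0 : ∫ x, (Real.exp (A.indicator (fun _ => (n : ℝ)) x) - 1) ∂π = 0 := by
      refine integral_eq_zero_of_ae ?_
      filter_upwards [measure_eq_zero_iff_ae_notMem.1 hπA] with x hx
      simp [hx]
    rw [entropyDual, h0, integral_indicator_const _ hA, sub_zero, smul_eq_mul] at h
    linarith
  by_contra hne
  have hpos : 0 < σ.real A := ENNReal.toReal_pos hne (measure_ne_top _ _)
  obtain ⟨n, hn⟩ := exists_nat_gt (K / σ.real A)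
  rw [div_lt_iff₀ hpos] at hn
  exact absurd (key n) (not_le.2 hn)

lemma klFun_clamp_le {s M : ℝ} (hM : 0 ≤ M) :
    InformationTheory.klFun (max (Real.exp (-M)) (min (Real.exp M) s)) ≤
      s * Real.log (max (Real.exp (-M)) (min (Real.exp M) s)) -
        (max (Real.exp (-M)) (min (Real.exp M) s) - 1) := by
  have hle : Real.exp (-M) ≤ Real.exp M := Real.exp_le_exp.2 (by linarith)
  simp only [InformationTheory.klFun]
  rcases le_total s (Real.exp M) with h1 | h1
  · rw [min_eq_right h1]
    rcases le_total s (Real.exp (-M)) with h2 | h2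
    · rw [max_eq_left h2, Real.log_exp]
      nlinarith
    · rw [max_eq_right h2]
      linarith
  · rw [min_eq_left h1, max_eq_right hle, Real.log_exp]
    nlinarith

lemma abs_log_clamp_le {s M : ℝ} (hM : 0 ≤ M) :
    |Real.log (max (Real.exp (-M)) (min (Real.exp M) s))| ≤ M := by
  have hpos : 0 < max (Real.exp (-M)) (min (Real.exp M) s) :=
    (Real.exp_pos _).trans_le (le_max_left _ _)
  rw [abs_le, Real.le_log_iff_exp_le hpos, Real.log_le_iff_le_exp hpos]
  exact ⟨le_max_left _ _, max_le (Real.exp_le_exp.2 (by linarith)) (min_le_left _ _)⟩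

lemma tendsto_clamp_exp {s : ℝ} (hs : 0 ≤ s) :
    Tendsto (fun n : ℕ => max (Real.exp (-(n : ℝ))) (min (Real.exp n) s)) atTop (𝓝 s) := by
  have h1 : Tendsto (fun n : ℕ => Real.exp (-(n : ℝ))) atTop (𝓝 0) :=
    Real.tendsto_exp_neg_atTop_nhds_zero.comp tendsto_natCast_atTop_atTop
  have h2 : Tendsto (fun n : ℕ => min (Real.exp n) s) atTop (𝓝 s) := by
    refine tendsto_const_nhds.congr' ?_
    filter_upwards [(Real.tendsto_exp_atTop.comp tendsto_natCast_atTop_atTop).eventually_ge_atTop s]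
      with n hn
    exact (min_eq_right hn).symm
  simpa [max_eq_right hs] using h1.max h2

lemma lintegral_entT_le_of_entropyDual_le {α : Type*} [MeasurableSpace α] {π σ : Measure α}
    [IsFiniteMeasure π] [IsFiniteMeasure σ] (hσπ : σ ≪ π) {K : ℝ}
    (hK : ∀ f : α → ℝ, Measurable f → ∀ M, (∀ x, |f x| ≤ M) → entropyDual π σ f ≤ K) :
    ∫⁻ x, ENNReal.ofReal (entT (σ.rnDeriv π x).toReal) ∂π ≤ ENNReal.ofReal K := by
  let c : ℕ → α → ℝ := fun n x =>
    max (Real.exp (-(n : ℝ))) (min (Real.exp n) (σ.rnDeriv π x).toReal)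
  have hr : Measurable fun x => (σ.rnDeriv π x).toReal :=
    (Measure.measurable_rnDeriv σ π).ennreal_toReal
  have hc : ∀ n, Measurable (c n) := fun n => measurable_const.max (measurable_const.min hr)
  have hcpos : ∀ n x, 0 < c n x := fun n x => (Real.exp_pos _).trans_le (le_max_left _ _)
  have hlog : ∀ n, Measurable fun x => Real.log (c n x) := fun n => (hc n).log
  have hlogM : ∀ n x, |Real.log (c n x)| ≤ n := fun n x => abs_log_clamp_le n.cast_nonneg
  have hle : ∀ n, ∫⁻ x, ENNReal.ofReal (InformationTheory.klFun (c n x)) ∂π ≤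
      ENNReal.ofReal K := fun n => by
    let G : α → ℝ := fun x => (σ.rnDeriv π x).toReal * Real.log (c n x) - (c n x - 1)
    have hklG : ∀ x, InformationTheory.klFun (c n x) ≤ G x := fun x =>
      klFun_clamp_le n.cast_nonneg
    have h1 : Integrable (fun x => (σ.rnDeriv π x).toReal * Real.log (c n x)) π :=
      (integrable_rnDeriv_smul_iff hσπ).2 (integrable_of_abs_le (hlog n) (hlogM n))
    have h2 : Integrable (fun x => c n x - 1) π := by
      refine Integrable.sub ?_ (integrable_const _)
      simpa only [Real.exp_log (hcpos n _)] using
        integrable_exp_of_abs_le (π := π) (hlog n) (hlogM n)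
    calc ∫⁻ x, ENNReal.ofReal (InformationTheory.klFun (c n x)) ∂π
        ≤ ∫⁻ x, ENNReal.ofReal (G x) ∂π :=
          lintegral_mono fun x => ENNReal.ofReal_le_ofReal (hklG x)
      _ = ENNReal.ofReal (∫ x, G x ∂π) := by
          refine (ofReal_integral_eq_lintegral_ofReal (h1.sub h2)
            (Eventually.of_forall fun x => ?_)).symm
          exact (InformationTheory.klFun_nonneg (hcpos n x).le).trans (hklG x)
      _ ≤ ENNReal.ofReal K := by
          refine ENNReal.ofReal_le_ofReal ?_
          have h := hK _ (hlog n) n (hlogM n)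
          rw [entropyDual, ← integral_toReal_rnDeriv_mul hσπ] at h
          simp only [Real.exp_log (hcpos n _)] at h
          rwa [← integral_sub h1 h2] at h
  calc ∫⁻ x, ENNReal.ofReal (entT (σ.rnDeriv π x).toReal) ∂π
      = ∫⁻ x, liminf (fun n => ENNReal.ofReal (InformationTheory.klFun (c n x))) atTop ∂π := by
        refine lintegral_congr fun x => ?_
        rw [entT_eq_klFun]
        refine (Tendsto.liminf_eq ?_).symm
        exact ENNReal.tendsto_ofReal ((InformationTheory.continuous_klFun.tendsto _).comp
          (tendsto_clamp_exp ENNReal.toReal_nonneg))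
    _ ≤ liminf (fun n => ∫⁻ x, ENNReal.ofReal (InformationTheory.klFun (c n x)) ∂π) atTop :=
        lintegral_liminf_le fun n =>
          (InformationTheory.measurable_klFun.comp (hc n)).ennreal_ofReal
    _ ≤ liminf (fun _ : ℕ => ENNReal.ofReal K) atTop :=
        liminf_le_liminf (Eventually.of_forall hle)
    _ = ENNReal.ofReal K := liminf_const _

/-- The entropy is the supremum of its dual functional over bounded continuous functions. -/
lemma entropyH_eq_iSup {α : Type*} [MeasurableSpace α] [TopologicalSpace α]
    [TopologicalSpace.PseudoMetrizableSpace α] [BorelSpace α] (π σ : Measure α)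
    [IsFiniteMeasure π] [IsFiniteMeasure σ] :
    entropyH π σ = ⨆ f : α →ᵇ ℝ, ENNReal.ofReal (entropyDual π σ f) := by
  refine le_antisymm ?_ (iSup_le fun f =>
    ofReal_entropyDual_le f.continuous.measurable (M := ‖f‖) f.norm_coe_le_norm)
  by_cases htop : ⨆ f : α →ᵇ ℝ, ENNReal.ofReal (entropyDual π σ f) = ⊤
  · rw [htop]; exact le_top
  set S := ⨆ f : α →ᵇ ℝ, ENNReal.ofReal (entropyDual π σ f)
  have hK : ∀ f : α → ℝ, Measurable f → ∀ M, (∀ x, |f x| ≤ M) →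
      entropyDual π σ f ≤ S.toReal := fun f hf M hM =>
    entropyDual_le_of_forall_continuous (fun g => (ENNReal.ofReal_le_iff_le_toReal htop).1
      (le_iSup (fun f : α →ᵇ ℝ => ENNReal.ofReal (entropyDual π σ f)) g)) hf hM
  have hac := absolutelyContinuous_of_entropyDual_le hK
  rw [entropyH, if_pos hac, ← ENNReal.ofReal_toReal htop]
  exact lintegral_entT_le_of_entropyDual_le hac hK

/-- Integrating out the first variable of a bounded continuous function against a fixed finite
measure yields a bounded continuous function of the second variable. -/
lemma exists_boundedContinuous_eq_integral_left {α β : Type*} [TopologicalSpace α]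
    [TopologicalSpace β] [FirstCountableTopology β] [MeasurableSpace α] [OpensMeasurableSpace α]
    (m : Measure α) [IsFiniteMeasure m] (g : α × β →ᵇ ℝ) :
    ∃ G : β →ᵇ ℝ, ∀ y, G y = ∫ x, g (x, y) ∂m := by
  refine ⟨BoundedContinuousFunction.ofNormedAddCommGroup (fun y => ∫ x, g (x, y) ∂m) ?_
    (‖g‖ * m.real univ) fun y => ?_, fun y => rfl⟩
  · refine continuous_of_dominated (bound := fun _ => ‖g‖) (fun y => ?_)
      (fun y => Eventually.of_forall fun x => g.norm_coe_le_norm _) (integrable_const _)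
      (Eventually.of_forall fun x => by fun_prop)
    exact (show Continuous fun x => g (x, y) by fun_prop).measurable.aestronglyMeasurable
  · exact norm_integral_le_of_norm_le_const (Eventually.of_forall fun x => g.norm_coe_le_norm _)

lemma WeakStarTendsto.prod_left {α β : Type*} [TopologicalSpace α] [TopologicalSpace β]
    [FirstCountableTopology β] [MeasurableSpace α] [MeasurableSpace β]
    [OpensMeasurableSpace α] [OpensMeasurableSpace (α × β)]
    (m : Measure α) [IsFiniteMeasure m] {νs : ℕ → Measure β} {ν : Measure β}
    [∀ n, IsFiniteMeasure (νs n)] [IsFiniteMeasure ν] (h : WeakStarTendsto νs ν) :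
    WeakStarTendsto (fun n => m.prod (νs n)) (m.prod ν) := by
  intro g
  obtain ⟨G, hG⟩ := exists_boundedContinuous_eq_integral_left m g
  have e : ∀ τ : Measure β, IsFiniteMeasure τ → ∫ p, g p ∂(m.prod τ) = ∫ y, G y ∂τ :=
    fun τ _ => by
      rw [integral_prod_symm _ (g.integrable _)]
      simp only [hG]
  simpa only [e _ inferInstance] using h G

lemma WeakStarTendsto.entropyDual {α : Type*} [TopologicalSpace α] [MeasurableSpace α]
    {πs σs : ℕ → Measure α} {π σ : Measure α} (hπ : WeakStarTendsto πs π)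
    (hσ : WeakStarTendsto σs σ) (f : α →ᵇ ℝ) :
    Tendsto (fun n => entropyDual (πs n) (σs n) f) atTop (𝓝 (entropyDual π σ f)) := by
  refine (hσ f).sub ?_
  exact hπ (BoundedContinuousFunction.ofNormedAddCommGroup (fun x => Real.exp (f x) - 1)
    (by fun_prop) (Real.exp ‖f‖ + 1) fun x => by
      have h1 : Real.exp (f x) ≤ Real.exp ‖f‖ :=
        Real.exp_le_exp.2 ((le_abs_self _).trans (f.norm_coe_le_norm x))
      have h2 := Real.exp_pos (f x)
      rw [Real.norm_eq_abs, abs_le]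
      constructor <;> linarith)

/-- Image measures under a continuous map pass to weak* limits. -/
lemma WeakStarTendsto.map_eq_of_frequently {α β : Type*} [TopologicalSpace α]
    [MeasurableSpace α] [BorelSpace α] [TopologicalSpace β] [MeasurableSpace β] [BorelSpace β]
    [HasOuterApproxClosed β] {ρs : ℕ → Measure α} {ρ : Measure α} {μs : ℕ → Measure β}
    {μ : Measure β} [IsFiniteMeasure ρ] [IsFiniteMeasure μ] (hρ : WeakStarTendsto ρs ρ)
    (hμ : WeakStarTendsto μs μ) {T : α → β} (hT : Continuous T) (hTm : Measurable T)
    (h : ∃ᶠ n in atTop, (ρs n).map T = μs n) : ρ.map T = μ := by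
  have : IsFiniteMeasure (ρ.map T) := inferInstance
  refine ext_of_forall_integral_eq_of_IsFiniteMeasure fun f => ?_
  have e : ∀ τ : Measure α, ∫ y, f y ∂(τ.map T) = ∫ x, f.compContinuous ⟨T, hT⟩ x ∂τ :=
    fun τ => integral_map hTm.aemeasurable f.continuous.measurable.aestronglyMeasurable
  have hlim := (hρ (f.compContinuous ⟨T, hT⟩)).sub (hμ f)
  have h0 := isClosed_singleton.mem_of_frequently_of_tendsto (s := {(0 : ℝ)})
    (h.mono fun n hn => by rw [← e, hn, sub_self]; rfl) hlim
  rw [e]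
  exact sub_eq_zero.1 h0

lemma exists_boundedContinuous_eqOn {α : Type*} [TopologicalSpace α] [T2Space α] [NormalSpace α]
    {K : Set α} (hK : IsCompact K) {V : α → ℝ} (hV : ContinuousOn V K) :
    ∃ W : α →ᵇ ℝ, EqOn W V K := by
  have : CompactSpace K := isCompact_iff_compactSpace.1 hK
  obtain ⟨W, -, hW⟩ := BoundedContinuousFunction.exists_norm_eq_domRestrict_eq_of_closed
    (BoundedContinuousFunction.mkOfCompact ⟨K.domRestrict V, hV.domRestrict⟩) hK.isClosed
  exact ⟨W, fun x hx => DFunLike.congr_fun hW ⟨x, hx⟩⟩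

lemma lintegral_ofReal_eq_of_eqOn {α : Type*} [TopologicalSpace α] [MeasurableSpace α]
    [OpensMeasurableSpace α] {K : Set α} {V : α → ℝ} (hV0 : ∀ x, 0 ≤ V x) {W : α →ᵇ ℝ}
    (hW : EqOn W V K) (τ : Measure α) [IsFiniteMeasure τ] (hτ : τ Kᶜ = 0) :
    ∫⁻ x, ENNReal.ofReal (V x) ∂τ = ENNReal.ofReal (∫ x, W x ∂τ) := by
  have hae : ∀ᵐ x ∂τ, x ∈ K := hτ
  rw [ofReal_integral_eq_lintegral_ofReal (W.integrable τ)
    (hae.mono fun x hx => by simpa [hW hx] using hV0 x)]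
  exact lintegral_congr_ae (hae.mono fun x hx => by simp only [hW hx])

/-- joint lower semicontinuity of the marginal-dependent energy `E(· | ·, ·)`
under weak* convergence of plans and marginals. -/
theorem stmt8 {d d' : ℕ} (X : Set (Euc d)) (Y : Set (Euc d'))
    (hX : IsCompact X) (hXne : X.Nonempty) (hY : IsCompact Y) (hYne : Y.Nonempty)
    (V : Euc d × Euc d' → ℝ) (hV : ContinuousOn V (X ×ˢ Y)) (hV0 : ∀ p, 0 ≤ V p)
    (κ : ℝ) (hκ : 0 < κ)
    (μs : ℕ → Measure (Euc d)) (μ : Measure (Euc d))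
    (hμsP : ∀ n, IsProbabilityMeasure (μs n)) [IsProbabilityMeasure μ]
    (hμsX : ∀ n, μs n Xᶜ = 0) (hμX : μ Xᶜ = 0)
    (νs : ℕ → Measure (Euc d')) (ν : Measure (Euc d'))
    (hνsP : ∀ n, IsProbabilityMeasure (νs n)) [IsProbabilityMeasure ν]
    (hνsY : ∀ n, νs n Yᶜ = 0) (hνY : ν Yᶜ = 0)
    (ρs : ℕ → Measure (Euc d × Euc d')) (ρ : Measure (Euc d × Euc d'))
    (hρsP : ∀ n, IsProbabilityMeasure (ρs n)) [IsProbabilityMeasure ρ]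
    (hρsXY : ∀ n, ρs n ((X ×ˢ Y)ᶜ) = 0) (hρXY : ρ ((X ×ˢ Y)ᶜ) = 0)
    (hμconv : WeakStarTendsto μs μ)
    (hνconv : WeakStarTendsto νs ν)
    (hρconv : WeakStarTendsto ρs ρ) :
    energyMid X V κ ρ μ ν ≤ liminf (fun n => energyMid X V κ (ρs n) (μs n) (νs n)) atTop := by
  by_cases hfreq : ∃ᶠ n in atTop, ρs n ∈ Couplings (μs n) (νs n)
  swap
  · have htop : ∀ᶠ n in atTop, ⊤ ≤ energyMid X V κ (ρs n) (μs n) (νs n) :=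
      (not_frequently.1 hfreq).mono fun n hn => by simp [energyMid, hn]
    exact le_top.trans (le_liminf_of_le (by isBoundedDefault) htop)
  have hcoup : ρ ∈ Couplings μ ν :=
    ⟨inferInstance,
      hρconv.map_eq_of_frequently hμconv continuous_fst measurable_fst
        (hfreq.mono fun n hn => hn.2.1),
      hρconv.map_eq_of_frequently hνconv continuous_snd measurable_snd
        (hfreq.mono fun n hn => hn.2.2)⟩
  have : IsFiniteMeasure (volume.restrict X) := ⟨by simpa using hX.measure_lt_top⟩
  have hfin : ∀ τ : Measure (Euc d'), IsFiniteMeasure τ → IsFiniteMeasure (Lref X τ) :=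
    fun τ _ => by unfold Lref; infer_instance
  have : IsFiniteMeasure (Lref X ν) := hfin ν inferInstance
  have : ∀ n, IsFiniteMeasure (Lref X (νs n)) := fun n => hfin (νs n) inferInstance
  have hLconv : WeakStarTendsto (fun n => Lref X (νs n)) (Lref X ν) :=
    hνconv.prod_left (volume.restrict X)
  obtain ⟨W, hW⟩ := exists_boundedContinuous_eqOn (hX.prod hY) hV
  rw [energyMid, if_pos hcoup, entropyH_eq_iSup, ENNReal.mul_iSup, ENNReal.add_iSup]
  refine iSup_le fun f => ?_
  have hlim : Tendsto (fun n => ∫⁻ p, ENNReal.ofReal (V p) ∂(ρs n) +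
        ENNReal.ofReal κ * ENNReal.ofReal (entropyDual (Lref X (νs n)) (ρs n) f)) atTop
      (𝓝 (∫⁻ p, ENNReal.ofReal (V p) ∂ρ +
        ENNReal.ofReal κ * ENNReal.ofReal (entropyDual (Lref X ν) ρ f))) := by
    simp only [lintegral_ofReal_eq_of_eqOn hV0 hW ρ hρXY,
      lintegral_ofReal_eq_of_eqOn hV0 hW (ρs _) (hρsXY _)]
    exact (ENNReal.tendsto_ofReal (hρconv W)).add (ENNReal.Tendsto.const_mul
      (ENNReal.tendsto_ofReal (hLconv.entropyDual hρconv f)) (Or.inr ENNReal.ofReal_ne_top))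
  rw [← hlim.liminf_eq]
  refine liminf_le_liminf (Eventually.of_forall fun n => ?_)
  unfold energyMid
  split_ifs
  · gcongr
    exact ofReal_entropyDual_le f.continuous.measurable (M := ‖f‖) f.norm_coe_le_norm
  · exact le_top

end
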